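/- For every natural number n there exist constants C > 0 and λ₀ > 0 such that for all real λ ≥ λ₀, the convergent series T_n(λ) = ∑_{l=0}^{∞} l^n/D_λ(l) satisfies |T_n(λ) − λ^{n+1}/((n+1)(n+2)) − λ^n·(log λ)/2| ≤ C·λ^n. -/

import Mathlib

/-- `D lam l = ∑_{k=0}^{l} l! / ((l-k)! * lam^k)`. -/
noncomputable def D (lam : ℝ) (l : ℕ) : ℝ :=
  ∑ k ∈ Finset.range (l + 1),
    (Nat.factorial l : ℝ) / ((Nat.factorial (l - k) : ℝ) * lam ^ k)

open Finset Real

section PowerSums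

theorem pow_succ_sub_pow_succ_le {x y : ℝ} (hx : 0 ≤ x) (hxy : x ≤ y) (k : ℕ) :
    y ^ (k + 1) - x ^ (k + 1) ≤ (k + 1) * y ^ k * (y - x) := by
  induction k with
  | zero => simp
  | succ k ih =>
    have h1 := mul_le_mul_of_nonneg_left ih (hx.trans hxy)
    have h2 := mul_le_mul_of_nonneg_right (pow_le_pow_left₀ hx hxy (k + 1)) (sub_nonneg.2 hxy)
    push_cast
    calc y ^ (k + 1 + 1) - x ^ (k + 1 + 1)
        = y * (y ^ (k + 1) - x ^ (k + 1)) + x ^ (k + 1) * (y - x) := by ring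
      _ ≤ y * ((k + 1) * y ^ k * (y - x)) + y ^ (k + 1) * (y - x) := add_le_add h1 h2
      _ = _ := by ring

theorem le_pow_succ_sub_pow_succ {x y : ℝ} (hx : 0 ≤ x) (hxy : x ≤ y) (k : ℕ) :
    (k + 1) * x ^ k * (y - x) ≤ y ^ (k + 1) - x ^ (k + 1) := by
  induction k with
  | zero => simp
  | succ k ih =>
    have h1 := mul_le_mul_of_nonneg_left ih hx
    have h2 := mul_le_mul_of_nonneg_right (pow_le_pow_left₀ hx hxy (k + 1)) (sub_nonneg.2 hxy)
    push_cast
    calc ((k : ℝ) + 1 + 1) * x ^ (k + 1) * (y - x)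
        = x * ((k + 1) * x ^ k * (y - x)) + x ^ (k + 1) * (y - x) := by ring
      _ ≤ x * (y ^ (k + 1) - x ^ (k + 1)) + y ^ (k + 1) * (y - x) := add_le_add h1 h2
      _ = _ := by ring

theorem pow_sub_pow_mul_le {x y : ℝ} (hx : 0 ≤ x) (hxy : x ≤ y) (k : ℕ) :
    (y ^ k - x ^ k) * y ≤ k * y ^ k * (y - x) := by
  cases k with
  | zero => simp
  | succ k =>
    have h := mul_le_mul_of_nonneg_right (pow_succ_sub_pow_succ_le hx hxy k) (hx.trans hxy)
    push_cast
    calc _ ≤ _ := h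
      _ = _ := by ring

theorem sum_range_pow_le (k m : ℕ) :
    (k + 1) * ∑ l ∈ range m, (l : ℝ) ^ k ≤ (m : ℝ) ^ (k + 1) := by
  induction m with
  | zero => simp
  | succ m ih =>
    have h := le_pow_succ_sub_pow_succ (Nat.cast_nonneg (α := ℝ) m)
      (by linarith : (m : ℝ) ≤ m + 1) k
    rw [sum_range_succ]
    push_cast
    linarith

theorem le_sum_range_pow (k m : ℕ) :
    (m : ℝ) ^ (k + 1) ≤ (k + 1) * (∑ l ∈ range m, (l : ℝ) ^ k + (m : ℝ) ^ k) := by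
  induction m with
  | zero => simp; positivity
  | succ m ih =>
    have h := pow_succ_sub_pow_succ_le (Nat.cast_nonneg (α := ℝ) m)
      (by linarith : (m : ℝ) ≤ m + 1) k
    rw [sum_range_succ]
    push_cast
    linarith

theorem abs_sum_range_pow_sub_le {x : ℝ} {m : ℕ} (hm : (m : ℝ) ≤ x) (hx : x ≤ m + 1) (k : ℕ) :
    |∑ l ∈ range m, (l : ℝ) ^ k - x ^ (k + 1) / (k + 1)| ≤ 2 * x ^ k := by
  have hm0 : (0 : ℝ) ≤ m := m.cast_nonneg
  have hk : (0 : ℝ) < k + 1 := by positivity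
  have hp : (m : ℝ) ^ k ≤ x ^ k := pow_le_pow_left₀ hm0 hm k
  have hp' : (m : ℝ) ^ (k + 1) ≤ x ^ (k + 1) := pow_le_pow_left₀ hm0 hm _
  have hxk : 0 ≤ x ^ k := pow_nonneg (hm0.trans hm) k
  have h1 := sum_range_pow_le k m
  have h2 := le_sum_range_pow k m
  have h3 : x ^ (k + 1) - (m : ℝ) ^ (k + 1) ≤ (k + 1) * x ^ k :=
    (pow_succ_sub_pow_succ_le hm0 hm k).trans
      (mul_le_of_le_one_right (by positivity) (by linarith))
  have h4 := mul_le_mul_of_nonneg_left hp hk.le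
  rw [abs_le]
  constructor
  · have : x ^ (k + 1) / (k + 1) ≤ ∑ l ∈ range m, (l : ℝ) ^ k + 2 * x ^ k := by
      rw [div_le_iff₀ hk]; linarith
    linarith
  · have : ∑ l ∈ range m, (l : ℝ) ^ k ≤ x ^ (k + 1) / (k + 1) := by
      rw [le_div_iff₀ hk]; linarith
    linarith

/-- The fluid approximation `1 - l / x` of `1 / D x l` contributes the leading term. -/
theorem abs_sum_range_fluid_sub_le {x : ℝ} {m : ℕ} (hx0 : 0 < x) (hm : (m : ℝ) ≤ x)
    (hx : x ≤ m + 1) (n : ℕ) :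
    |∑ l ∈ range m, (l : ℝ) ^ n * (1 - l / x) - x ^ (n + 1) / ((n + 1) * (n + 2))|
      ≤ 4 * x ^ n := by
  have h1 := abs_sum_range_pow_sub_le hm hx n
  have h2 := abs_sum_range_pow_sub_le hm hx (n + 1)
  have hsum : ∑ l ∈ range m, (l : ℝ) ^ n * (1 - l / x)
      = ∑ l ∈ range m, (l : ℝ) ^ n - (∑ l ∈ range m, (l : ℝ) ^ (n + 1)) / x := by
    rw [sum_div, ← sum_sub_distrib]
    exact sum_congr rfl fun l _ => by ring
  have h3 : |(∑ l ∈ range m, (l : ℝ) ^ (n + 1)) / x - x ^ (n + 1) / (n + 2)| ≤ 2 * x ^ n := by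
    have : (∑ l ∈ range m, (l : ℝ) ^ (n + 1)) / x - x ^ (n + 1) / (n + 2)
        = (∑ l ∈ range m, (l : ℝ) ^ (n + 1) - x ^ (n + 1 + 1) / ((n + 1 : ℕ) + 1)) / x := by
      push_cast
      field_simp
      ring
    rw [this, abs_div, abs_of_pos hx0, div_le_iff₀ hx0]
    calc _ ≤ _ := h2
      _ = _ := by ring
  have h4 : x ^ (n + 1) / ((n + 1) * (n + 2)) = x ^ (n + 1) / (n + 1) - x ^ (n + 1) / (n + 2) := by
    field_simp
    ring
  rw [hsum, h4]
  rw [abs_le] at *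
  constructor <;> linarith [h1.1, h1.2, h3.1, h3.2]

end PowerSums

section Blocking

variable {lam : ℝ}

theorem D_zero (lam : ℝ) : D lam 0 = 1 := by simp [D]

theorem D_succ (lam : ℝ) (l : ℕ) : D lam (l + 1) = 1 + (l + 1) / lam * D lam l := by
  unfold D
  rw [sum_range_succ', mul_sum, add_comm]
  congr 1
  · simp [Nat.factorial_ne_zero]
  · refine sum_congr rfl fun k _ => ?_
    rw [Nat.add_sub_add_right, Nat.factorial_succ, pow_succ]
    push_cast
    rw [div_mul_div_comm]
    congr 1
    ring

theorem one_le_D (h : 0 < lam) (l : ℕ) : 1 ≤ D lam l := by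
  induction l with
  | zero => rw [D_zero]
  | succ l ih =>
    rw [D_succ]
    have : 0 ≤ (l + 1) / lam * D lam l := by positivity
    linarith

theorem D_pos (h : 0 < lam) (l : ℕ) : 0 < D lam l := one_pos.trans_le (one_le_D h l)

/-- One plus the scaled deviation of `1 / D lam l` from its fluid approximation `1 - l / lam`. -/
noncomputable def excess (lam : ℝ) (l : ℕ) : ℝ := lam / D lam l + l - lam + 1

theorem excess_zero (lam : ℝ) : excess lam 0 = 1 := by simp [excess, D_zero]

theorem excess_succ (h : 0 < lam) (l : ℕ) :
    excess lam (l + 1) = 1 + (l + 1) * excess lam l / (lam + excess lam l) := by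
  have hD := D_pos h l
  have hD' := D_pos h (l + 1)
  have h1 : lam + excess lam l = lam * D lam (l + 1) / D lam l := by
    rw [D_succ]; unfold excess; field_simp; ring
  rw [h1]
  unfold excess
  have h2 := D_succ lam l
  field_simp at h2 ⊢
  push_cast
  linear_combination (l + 1 - lam) * h2

theorem one_le_excess (h : 0 < lam) (l : ℕ) : 1 ≤ excess lam l := by
  induction l with
  | zero => rw [excess_zero]
  | succ l ih =>
    rw [excess_succ h]
    have : 0 ≤ (l + 1) * excess lam l / (lam + excess lam l) := by positivity
    linarith

theorem div_add_self_le_div_add_self (h : 0 < lam) {u v : ℝ} (hu : 0 ≤ u) (huv : u ≤ v) :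
    u / (lam + u) ≤ v / (lam + v) := by
  rw [div_le_div_iff₀ (by linarith) (by linarith)]
  nlinarith

theorem excess_monotone (h : 0 < lam) : Monotone (excess lam) := by
  refine monotone_nat_of_le_succ fun l => ?_
  induction l with
  | zero => rw [excess_zero]; exact one_le_excess h _
  | succ l ih =>
    have h0 := one_le_excess h l
    rw [excess_succ h l, excess_succ h (l + 1), mul_div_assoc, mul_div_assoc]
    have h1 := div_add_self_le_div_add_self h (by linarith) ih
    have h2 : 0 ≤ excess lam l / (lam + excess lam l) := by positivity
    push_cast
    gcongr
    linarith

theorem excess_le (h : 0 < lam) {l : ℕ} (hl : (l : ℝ) < lam) : excess lam l ≤ lam / (lam - l) := by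
  induction l with
  | zero => simp [excess_zero, h.ne']
  | succ l ih =>
    push_cast at hl ⊢
    have h0 := one_le_excess h l
    have ha : 0 < lam - l - 1 := by linarith
    have ih' := ih (by linarith)
    rw [excess_succ h]
    have h1 : (l + 1) * excess lam l / (lam + excess lam l)
        ≤ (l + 1) * (lam / (lam - l)) / lam := by
      gcongr
      · have : 0 < lam - l := by linarith
        positivity
      · linarith
    have h2 : (l + 1) * (lam / (lam - l)) / lam = (l + 1) / (lam - l) := by
      field_simp
    have h3 : (l + 1) / (lam - l) ≤ (l + 1) / (lam - (l + 1)) := by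
      gcongr
      linarith
    have h4 : lam / (lam - (l + 1)) = 1 + (l + 1) / (lam - (l + 1)) := by
      have : lam - (l + 1) ≠ 0 := by linarith
      field_simp
      ring
    linarith

theorem le_excess (h : 0 < lam) {l : ℕ} (hl : (l : ℝ) < lam) :
    lam / (lam - l) - 2 * lam ^ 2 / (lam - l) ^ 3 ≤ excess lam l := by
  induction l with
  | zero =>
    rw [excess_zero]
    have : 0 ≤ 2 * lam ^ 2 / lam ^ 3 := by positivity
    simp only [Nat.cast_zero, sub_zero, div_self h.ne']
    linarith
  | succ l ih =>
    push_cast at hl ⊢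
    have h0 := one_le_excess h l
    have hub := excess_le h (by linarith : (l : ℝ) < lam)
    have ih' := ih (by linarith)
    rw [excess_succ h]
    obtain ⟨b, hb⟩ : ∃ b, b = lam - (l + 1) := ⟨_, rfl⟩
    have hb0 : 0 < b := by linarith
    have hl1 : (l : ℝ) + 1 = lam - b := by linarith
    have hbl : b ≤ lam := by linarith [l.cast_nonneg (α := ℝ)]
    have hal : lam - l = b + 1 := by linarith
    rw [hal] at ih' hub
    rw [← hb, hl1]
    set f := excess lam l
    have h1 : f / lam - 1 / (b + 1) ^ 2 ≤ f / (lam + f) := by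
      have e1 : f / lam - (f / lam) ^ 2 ≤ f / (lam + f) := by
        rw [le_div_iff₀ (by linarith)]
        have : (f / lam - (f / lam) ^ 2) * (lam + f) = f - f ^ 3 / lam ^ 2 := by
          field_simp; ring
        rw [this]
        have : 0 ≤ f ^ 3 / lam ^ 2 := by positivity
        linarith
      have e2 : (f / lam) ^ 2 ≤ 1 / (b + 1) ^ 2 := by
        rw [← one_div_pow]
        refine pow_le_pow_left₀ (by positivity) ?_ 2
        rw [div_le_iff₀ h]
        calc f ≤ _ := hub
          _ = _ := by ring
      linarith
    have h2 : (lam - b) * (f / lam - 1 / (b + 1) ^ 2) ≤ (lam - b) * (f / (lam + f)) :=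
      mul_le_mul_of_nonneg_left h1 (by linarith)
    have h3 : (1 / (b + 1) - 2 * lam / (b + 1) ^ 3) ≤ f / lam := by
      rw [le_div_iff₀ h]
      calc _ = _ := by ring
        _ ≤ f := ih'
    have h4 : (lam - b) * (1 / (b + 1) - 2 * lam / (b + 1) ^ 3) ≤ (lam - b) * (f / lam) :=
      mul_le_mul_of_nonneg_left h3 (by linarith)
    have h5 : 1 / (b + 1) ^ 3 ≤ 1 / b ^ 3 := by gcongr; linarith
    have h6 : 1 / b - 1 / (b + 1) ≤ 1 / b ^ 2 := by
      have : 1 / b - 1 / (b + 1) = 1 / (b * (b + 1)) := by field_simp; ring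
      rw [this]
      gcongr
      nlinarith
    have h7 : 1 / (b + 1) ^ 2 ≤ 1 / b ^ 2 := by gcongr; linarith
    have h8 : (lam - b) * (1 / b - 1 / (b + 1) + 1 / (b + 1) ^ 2) ≤ lam * (2 * (1 / b ^ 2)) := by
      have : 0 ≤ 1 / b - 1 / (b + 1) := sub_nonneg.2 (by gcongr; linarith)
      have h9 : 0 ≤ 1 / (b + 1) ^ 2 := by positivity
      exact mul_le_mul (by linarith) (by linarith) (by linarith) h.le
    have h9 : (lam - b) * (2 * lam) * (1 / (b + 1) ^ 3) ≤ (lam - b) * (2 * lam) * (1 / b ^ 3) :=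
      mul_le_mul_of_nonneg_left h5 (by have : 0 ≤ lam - b := by linarith
                                       positivity)
    have h10 : lam / b - 2 * lam ^ 2 / b ^ 3
        = 1 + (lam - b) * (1 / b) - (lam - b) * (2 * lam) * (1 / b ^ 3)
          - lam * (2 * (1 / b ^ 2)) := by
      field_simp; ring
    rw [h10, mul_div_assoc]
    have h11 : (lam - b) * (1 / (b + 1) - 2 * lam / (b + 1) ^ 3)
      = (lam - b) * (1 / (b + 1)) - (lam - b) * (2 * lam) * (1 / (b + 1) ^ 3) := by ring
    linarith

theorem excess_le_two_mul_sqrt (h : 1 ≤ lam) {l : ℕ} (hl : (l : ℝ) ≤ lam) :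
    excess lam l ≤ 2 * √lam := by
  have h0 : 0 < lam := by linarith
  have hs : 1 ≤ √lam := Real.one_le_sqrt.2 h
  have hsq : √lam ^ 2 = lam := Real.sq_sqrt h0.le
  induction l with
  | zero => rw [excess_zero]; linarith
  | succ l ih =>
    push_cast at hl
    have ih' := ih (by linarith)
    have hf := one_le_excess h0 l
    rw [excess_succ h0, mul_div_assoc]
    have h1 := div_add_self_le_div_add_self h0 (by linarith) ih'
    have h2 : ((l : ℝ) + 1) * (excess lam l / (lam + excess lam l))
        ≤ lam * (2 * √lam / (lam + 2 * √lam)) := by gcongr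
    have h3 : lam * (2 * √lam / (lam + 2 * √lam)) ≤ 2 * √lam - 1 := by
      rw [← mul_div_assoc, div_le_iff₀ (by linarith)]
      nlinarith
    linarith

theorem sqrt_div_six_le_excess (h : 4 ≤ lam) {l : ℕ} (hl : lam ≤ l + 1) :
    √lam / 6 ≤ excess lam l := by
  have h0 : 0 < lam := by linarith
  have hs : 2 ≤ √lam := Real.le_sqrt_of_sq_le (by linarith)
  have hsq : √lam ^ 2 = lam := Real.sq_sqrt h0.le
  have hnn : 0 ≤ lam - 2 * √lam := by nlinarith
  have h1 := Nat.floor_le hnn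
  have h2 := Nat.lt_floor_add_one (lam - 2 * √lam)
  set k := ⌊lam - 2 * √lam⌋₊
  have hkl : k ≤ l := by
    have : (k : ℝ) ≤ l := by linarith
    exact_mod_cast this
  refine le_trans ?_ (excess_monotone h0 hkl)
  refine le_trans ?_ (le_excess h0 (by linarith))
  obtain ⟨a, ha⟩ : ∃ a, a = lam - k := ⟨_, rfl⟩
  rw [← ha]
  have ha1 : 2 * √lam ≤ a := by linarith
  have ha2 : a ≤ 3 * √lam := by linarith
  have ha0 : 0 < a := by linarith
  have h3 : lam / a - 2 * lam ^ 2 / a ^ 3 = lam / a * (1 - 2 * lam / a ^ 2) := by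
    field_simp
  have h4 : 2 * lam / a ^ 2 ≤ 1 / 2 := by
    rw [div_le_iff₀ (by positivity)]; nlinarith
  have h5 : √lam / 3 ≤ lam / a := by
    rw [le_div_iff₀ ha0]; nlinarith
  rw [h3]
  nlinarith

theorem one_div_D_succ_mul_excess (h : 0 < lam) (l : ℕ) :
    1 / D lam (l + 1) * excess lam l = lam * (1 / D lam l - 1 / D lam (l + 1)) := by
  have hD := D_pos h l
  have hD' := D_pos h (l + 1)
  have h2 := D_succ lam l
  unfold excess
  field_simp at h2 ⊢
  linear_combination -h2

theorem one_div_D_le (h : 1 ≤ lam) {m : ℕ} (hm : (m : ℝ) ≤ lam) (hm' : lam ≤ m + 1) :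
    √lam * (1 / D lam m) ≤ 2 := by
  have h0 : 0 < lam := by linarith
  have hs : 1 ≤ √lam := Real.one_le_sqrt.2 h
  have hsq : √lam ^ 2 = lam := Real.sq_sqrt h0.le
  have h1 := excess_le_two_mul_sqrt h hm
  have h2 : lam * (1 / D lam m) ≤ 2 * √lam := by
    have : lam * (1 / D lam m) = excess lam m - m + lam - 1 := by unfold excess; ring
    linarith
  nlinarith

theorem sum_one_div_D_tail_le (h : 4 ≤ lam) {m : ℕ} (hm : (m : ℝ) ≤ lam) (hm' : lam ≤ m + 1)
    (N : ℕ) : ∑ i ∈ range N, 1 / D lam (m + i) ≤ 13 := by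
  have h0 : 0 < lam := by linarith
  have hs : 2 ≤ √lam := Real.le_sqrt_of_sq_le (by linarith)
  have hsq : √lam ^ 2 = lam := Real.sq_sqrt h0.le
  have hstep (i : ℕ) : 1 / D lam (m + (i + 1))
      ≤ 6 * √lam * (1 / D lam (m + i)) - 6 * √lam * (1 / D lam (m + (i + 1))) := by
    have h1 := one_div_D_succ_mul_excess h0 (m + i)
    have h2 : √lam / 6 ≤ excess lam (m + i) :=
      sqrt_div_six_le_excess h (by push_cast; linarith [i.cast_nonneg (α := ℝ)])
    have h3 : 0 < 1 / D lam (m + (i + 1)) := one_div_pos.2 (D_pos h0 _)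
    have h4 := mul_le_mul_of_nonneg_left h2 h3.le
    rw [add_assoc] at h1
    rw [h1] at h4
    refine le_of_mul_le_mul_left ?_ (by linarith : 0 < √lam / 6)
    calc _ ≤ _ := (mul_comm _ _).trans_le h4
      _ = √lam ^ 2 * (1 / D lam (m + i) - 1 / D lam (m + (i + 1))) := by rw [hsq]
      _ = _ := by ring
  have hsum : ∑ i ∈ range N, 1 / D lam (m + (i + 1)) ≤ 12 := by
    refine (sum_le_sum fun i _ => hstep i).trans ?_
    rw [sum_range_sub' (fun i => 6 * √lam * (1 / D lam (m + i)))]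
    have h1 := one_div_D_le (by linarith) hm hm'
    have h2 : 0 < 1 / D lam (m + N) := one_div_pos.2 (D_pos h0 _)
    have h3 : 0 ≤ √lam * (1 / D lam (m + N)) := by positivity
    simp only [add_zero]
    linarith
  calc ∑ i ∈ range N, 1 / D lam (m + i)
      ≤ ∑ i ∈ range (N + 1), 1 / D lam (m + i) :=
        sum_le_sum_of_subset_of_nonneg (range_mono N.le_succ)
          fun i _ _ => (one_div_pos.2 (D_pos h0 _)).le
    _ = ∑ i ∈ range N, 1 / D lam (m + (i + 1)) + 1 / D lam m := by
        rw [sum_range_succ']; rfl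
    _ ≤ 13 := by
        have : 1 / D lam m ≤ 1 := (div_le_one (D_pos h0 m)).2 (one_le_D h0 m)
        linarith

theorem descFactorial_div_D_le (h : 0 < lam) (n l : ℕ) :
    ((l + n).descFactorial n : ℝ) / D lam (l + n) ≤ lam ^ n * (1 / D lam l) := by
  induction n with
  | zero => simp
  | succ n ih =>
    have hD := D_pos h (l + n)
    have h1 : ((l + n : ℕ) + 1 : ℝ) / lam * D lam (l + n) ≤ D lam (l + n + 1) := by
      rw [D_succ]; linarith
    rw [← add_assoc, Nat.succ_descFactorial_succ, Nat.cast_mul]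
    calc (((l + n + 1 : ℕ) : ℝ) * (l + n).descFactorial n) / D lam (l + n + 1)
        ≤ (((l + n + 1 : ℕ) : ℝ) * (l + n).descFactorial n)
          / (((l + n : ℕ) + 1 : ℝ) / lam * D lam (l + n)) := by gcongr
      _ = lam * (((l + n).descFactorial n : ℝ) / D lam (l + n)) := by
          push_cast; field_simp
      _ ≤ lam * (lam ^ n * (1 / D lam l)) := by gcongr
      _ = _ := by ring

theorem pow_div_D_shift_le (h : 0 < lam) {n l : ℕ} (hl : n ≤ l) :
    ((l + n : ℕ) : ℝ) ^ n / D lam (l + n) ≤ 2 ^ n * lam ^ n * (1 / D lam l) := by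
  have hD := D_pos h (l + n)
  have h1 : ((l + n : ℕ) : ℝ) ^ n ≤ 2 ^ n * ((l + n).descFactorial n : ℝ) := by
    have h2 := Nat.pow_sub_le_descFactorial (l + n) n
    have h3 : (l + n) ^ n ≤ (2 * (l + n + 1 - n)) ^ n := Nat.pow_le_pow_left (by omega) n
    rw [mul_pow] at h3
    exact_mod_cast h3.trans (Nat.mul_le_mul_left _ h2)
  calc ((l + n : ℕ) : ℝ) ^ n / D lam (l + n)
      ≤ 2 ^ n * ((l + n).descFactorial n : ℝ) / D lam (l + n) := by gcongr
    _ = 2 ^ n * (((l + n).descFactorial n : ℝ) / D lam (l + n)) := by ring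
    _ ≤ 2 ^ n * (lam ^ n * (1 / D lam l)) := by gcongr; exact descFactorial_div_D_le h n l
    _ = _ := by ring

theorem sum_pow_div_D_tail_le (h : 4 ≤ lam) {m n : ℕ} (hm : (m : ℝ) ≤ lam) (hm' : lam ≤ m + 1)
    (hn : n ≤ m) (N : ℕ) :
    ∑ i ∈ range N, ((m + i : ℕ) : ℝ) ^ n / D lam (m + i) ≤ (n + 13) * 2 ^ n * lam ^ n := by
  have h0 : 0 < lam := by linarith
  have hhead : ∑ i ∈ range n, ((m + i : ℕ) : ℝ) ^ n / D lam (m + i) ≤ n * (2 ^ n * lam ^ n) := by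
    have : ∀ i ∈ range n, ((m + i : ℕ) : ℝ) ^ n / D lam (m + i) ≤ 2 ^ n * lam ^ n := by
      intro i hi
      have hi' : (i : ℝ) ≤ m := by exact_mod_cast (mem_range.1 hi).le.trans hn
      refine (div_le_self (by positivity) (one_le_D h0 _)).trans ?_
      rw [← mul_pow]
      refine pow_le_pow_left₀ (by positivity) ?_ n
      push_cast
      linarith
    simpa using sum_le_card_nsmul _ _ _ this
  have htail : ∑ i ∈ range N, ((m + (n + i) : ℕ) : ℝ) ^ n / D lam (m + (n + i))
      ≤ 2 ^ n * lam ^ n * 13 := by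
    have : ∀ i ∈ range N, ((m + (n + i) : ℕ) : ℝ) ^ n / D lam (m + (n + i))
        ≤ 2 ^ n * lam ^ n * (1 / D lam (m + i)) := by
      intro i _
      have := pow_div_D_shift_le h0 (by omega : n ≤ m + i)
      rwa [add_right_comm, add_assoc] at this
    refine (sum_le_sum this).trans ?_
    rw [← mul_sum]
    gcongr
    exact sum_one_div_D_tail_le h hm hm' N
  calc ∑ i ∈ range N, ((m + i : ℕ) : ℝ) ^ n / D lam (m + i)
      ≤ ∑ i ∈ range (n + N), ((m + i : ℕ) : ℝ) ^ n / D lam (m + i) :=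
        sum_le_sum_of_subset_of_nonneg (range_mono (Nat.le_add_left N n)) fun i _ _ =>
          div_nonneg (by positivity) (D_pos h0 _).le
    _ ≤ _ := by rw [sum_range_add]; linarith

end Blocking

section Logarithm

variable {x : ℝ} {p : ℕ}

theorem sum_one_div_sub_le_log (hp : (p : ℝ) < x) :
    ∑ l ∈ range p, 1 / (x - l) ≤ log x - log (x - p) := by
  have h : ∀ l ∈ range p, 1 / (x - l) ≤ log (x - l) - log (x - (l + 1 : ℕ)) := by
    intro l hl
    have hl' : ((l + 1 : ℕ) : ℝ) ≤ p := by exact_mod_cast mem_range.1 hl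
    push_cast at hl' ⊢
    have ha : 0 < x - (l + 1) := by linarith
    have ha' : 0 < x - l := by linarith
    have h1 := one_sub_inv_le_log_of_pos (div_pos ha' ha)
    rw [log_div ha'.ne' ha.ne', inv_div] at h1
    have h2 : 1 / (x - l) = 1 - (x - (l + 1)) / (x - l) := by field_simp; ring
    linarith
  refine (sum_le_sum h).trans ?_
  rw [sum_range_sub' (fun l : ℕ => log (x - l))]
  simp

theorem log_le_sum_one_div_sub (hp : (p : ℝ) < x) :
    log (x + 1) - log (x - p + 1) ≤ ∑ l ∈ range p, 1 / (x - l) := by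
  have h : ∀ l ∈ range p, log (x - l + 1) - log (x - (l + 1 : ℕ) + 1) ≤ 1 / (x - l) := by
    intro l hl
    have hl' : ((l + 1 : ℕ) : ℝ) ≤ p := by exact_mod_cast mem_range.1 hl
    push_cast at hl' ⊢
    have ha : 0 < x - l := by linarith
    have h1 := log_le_sub_one_of_pos (div_pos (by linarith : 0 < x - l + 1) ha)
    rw [log_div (by linarith) ha.ne'] at h1
    have h2 : (x - l + 1) / (x - l) - 1 = 1 / (x - l) := by field_simp; ring
    have h3 : x - (l + 1) + 1 = x - l := by ring
    rw [h3]
    linarith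
  refine le_trans ?_ (sum_le_sum h)
  rw [sum_range_sub' (fun l : ℕ => log (x - l + 1))]
  simp

theorem sum_one_div_sub_cube_le (hp : (p : ℝ) < x) :
    ∑ l ∈ range p, 1 / (x - l) ^ 3 ≤ 1 / (x - p) ^ 2 := by
  have h : ∀ l ∈ range p, 1 / (x - l) ^ 3 ≤ 1 / (x - (l + 1 : ℕ)) ^ 2 - 1 / (x - l) ^ 2 := by
    intro l hl
    have hl' : ((l + 1 : ℕ) : ℝ) ≤ p := by exact_mod_cast mem_range.1 hl
    push_cast at hl' ⊢
    obtain ⟨b, hb⟩ : ∃ b, b = x - (l + 1) := ⟨_, rfl⟩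
    have hb0 : 0 < b := by linarith
    have hbl : x - l = b + 1 := by linarith
    rw [← hb, hbl]
    have : 1 / b ^ 2 - 1 / (b + 1) ^ 2 = (2 * b + 1) / (b ^ 2 * (b + 1) ^ 2) := by
      field_simp; ring
    rw [this, div_le_div_iff₀ (by positivity) (by positivity)]
    have : 0 ≤ (b + 1) ^ 2 * ((2 * b + 1) * (b + 1) - b ^ 2) := by
      have : 0 ≤ (2 * b + 1) * (b + 1) - b ^ 2 := by nlinarith
      positivity
    nlinarith
  refine (sum_le_sum h).trans ?_
  rw [sum_range_sub (fun l : ℕ => 1 / (x - l) ^ 2)]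
  have : 0 ≤ 1 / x ^ 2 := by positivity
  simp only [Nat.cast_zero, sub_zero]
  linarith

theorem abs_sum_one_div_sub_sub_log_le (hx : 1 ≤ x) (hp : p + √x ≤ x) (hp' : x ≤ p + 1 + √x) :
    |∑ l ∈ range p, 1 / (x - l) - log x / 2| ≤ log 3 := by
  have hs : 1 ≤ √x := one_le_sqrt.2 hx
  have hlog : log (√x) = log x / 2 := log_sqrt (by linarith)
  have h1 := sum_one_div_sub_le_log (by linarith : (p : ℝ) < x)
  have h2 := log_le_sum_one_div_sub (by linarith : (p : ℝ) < x)
  have h3 : log (√x) ≤ log (x - p) := log_le_log (by linarith) (by linarith)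
  have h4 : log (x - p + 1) ≤ log (3 * √x) := log_le_log (by linarith) (by linarith)
  have h5 : log x ≤ log (x + 1) := log_le_log (by linarith) (by linarith)
  have h6 : 0 ≤ log 3 := log_nonneg (by norm_num)
  rw [log_mul (by norm_num) (by linarith)] at h4
  rw [abs_le]
  constructor <;> linarith

end Logarithm

section Correction

variable {lam : ℝ} {p : ℕ}

theorem pow_mul_excess_bounds (h : 0 < lam) {l : ℕ} (hl : (l : ℝ) < lam) (n : ℕ) :
    lam ^ n * (1 / (lam - l)) - (n + 1) * (lam ^ n / lam)
        - 2 * lam ^ (n + 1) * (1 / (lam - l) ^ 3) ≤ (l : ℝ) ^ n * ((excess lam l - 1) / lam) ∧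
      (l : ℝ) ^ n * ((excess lam l - 1) / lam) ≤ lam ^ n * (1 / (lam - l)) := by
  have h1 := excess_le h hl
  have h2 := le_excess h hl
  have h3 := pow_sub_pow_mul_le l.cast_nonneg hl.le n
  have hf := one_le_excess h l
  have hp : (l : ℝ) ^ n ≤ lam ^ n := pow_le_pow_left₀ l.cast_nonneg hl.le n
  obtain ⟨a, ha⟩ : ∃ a, a = lam - l := ⟨_, rfl⟩
  have ha0 : 0 < a := by linarith
  rw [← ha] at h1 h2 h3 ⊢
  have hup : (excess lam l - 1) / lam ≤ 1 / a := by
    rw [div_le_iff₀ h]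
    calc excess lam l - 1 ≤ lam / a := by linarith
      _ = _ := by ring
  have hlow : 1 / a - 2 * lam * (1 / a ^ 3) - 1 / lam ≤ (excess lam l - 1) / lam := by
    rw [le_div_iff₀ h]
    calc _ = lam / a - 2 * lam ^ 2 / a ^ 3 - 1 := by field_simp
      _ ≤ _ := by linarith
  constructor
  · have h4 := mul_le_mul_of_nonneg_left hlow (by positivity : 0 ≤ (l : ℝ) ^ n)
    have h5 : (lam ^ n - (l : ℝ) ^ n) * (1 / a) ≤ n * (lam ^ n / lam) := by
      rw [mul_one_div, ← mul_div_assoc, div_le_div_iff₀ ha0 h]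
      exact h3
    have h6 : (l : ℝ) ^ n * (2 * lam * (1 / a ^ 3)) ≤ lam ^ n * (2 * lam * (1 / a ^ 3)) := by
      gcongr
    have h7 : (l : ℝ) ^ n * (1 / lam) ≤ lam ^ n * (1 / lam) := by gcongr
    calc _ = lam ^ n * (1 / a) - n * (lam ^ n / lam) - lam ^ n * (2 * lam * (1 / a ^ 3))
          - lam ^ n * (1 / lam) := by ring
      _ ≤ (l : ℝ) ^ n * (1 / a - 2 * lam * (1 / a ^ 3) - 1 / lam) := by linarith
      _ ≤ _ := h4
  · refine mul_le_mul hp hup ?_ (by positivity)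
    exact div_nonneg (by linarith) h.le

theorem abs_sum_pow_mul_excess_sub_log_le (h : 1 ≤ lam) (hp : p + √lam ≤ lam)
    (hp' : lam ≤ p + 1 + √lam) (n : ℕ) :
    |∑ l ∈ range p, (l : ℝ) ^ n * ((excess lam l - 1) / lam) - lam ^ n * log lam / 2|
      ≤ (n + 3 + log 3) * lam ^ n := by
  have h0 : 0 < lam := by linarith
  have hs : 1 ≤ √lam := one_le_sqrt.2 h
  have hsq : √lam ^ 2 = lam := sq_sqrt h0.le
  have hlt : ∀ l ∈ range p, (l : ℝ) < lam := fun l hl => by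
    have : (l : ℝ) < p := by exact_mod_cast mem_range.1 hl
    linarith
  have hup := sum_le_sum fun l hl => (pow_mul_excess_bounds h0 (hlt l hl) n).2
  have hlow := sum_le_sum fun l hl => (pow_mul_excess_bounds h0 (hlt l hl) n).1
  simp only [sum_sub_distrib, ← mul_sum, sum_const, card_range, nsmul_eq_mul] at hlow
  rw [← mul_sum] at hup
  have hH := abs_le.1 (abs_sum_one_div_sub_sub_log_le h hp hp')
  have hpow : 0 < lam ^ n := by positivity
  have hH1 := mul_le_mul_of_nonneg_left hH.1 hpow.le
  have hH2 := mul_le_mul_of_nonneg_left hH.2 hpow.le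
  have hc : p * ((n + 1) * (lam ^ n / lam)) ≤ (n + 1) * lam ^ n := by
    calc p * ((n + 1) * (lam ^ n / lam)) ≤ lam * ((n + 1) * (lam ^ n / lam)) := by
          gcongr; linarith
      _ = _ := by field_simp
  have hcube : 2 * lam ^ (n + 1) * ∑ l ∈ range p, 1 / (lam - l) ^ 3 ≤ 2 * lam ^ n := by
    have h1 : ∑ l ∈ range p, 1 / (lam - l) ^ 3 ≤ 1 / lam := by
      refine (sum_one_div_sub_cube_le (by linarith)).trans ?_
      gcongr
      nlinarith
    calc _ ≤ 2 * lam ^ (n + 1) * (1 / lam) := by gcongr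
      _ = _ := by field_simp; ring
  have hn : 0 ≤ n * lam ^ n := by positivity
  rw [abs_le]
  constructor <;> nlinarith

theorem sum_Ico_pow_mul_excess_bounds (h : 1 ≤ lam) {m : ℕ} (hp' : lam ≤ p + 1 + √lam)
    (hpm : p ≤ m) (hm : (m : ℝ) ≤ lam) (n : ℕ) :
    0 ≤ ∑ l ∈ Ico p m, (l : ℝ) ^ n * ((excess lam l - 1) / lam) ∧
      ∑ l ∈ Ico p m, (l : ℝ) ^ n * ((excess lam l - 1) / lam) ≤ 4 * lam ^ n := by
  have h0 : 0 < lam := by linarith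
  have hs : 1 ≤ √lam := one_le_sqrt.2 h
  have hsq : √lam ^ 2 = lam := sq_sqrt h0.le
  have hnn (l : ℕ) : 0 ≤ (excess lam l - 1) / lam :=
    div_nonneg (by linarith [one_le_excess h0 l]) h0.le
  refine ⟨sum_nonneg fun l _ => mul_nonneg (by positivity) (hnn l), ?_⟩
  have hterm : ∀ l ∈ Ico p m,
      (l : ℝ) ^ n * ((excess lam l - 1) / lam) ≤ lam ^ n * (2 * √lam / lam) := by
    intro l hl
    have hl' : (l : ℝ) ≤ m := by exact_mod_cast (mem_Ico.1 hl).2.le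
    have hle := excess_le_two_mul_sqrt h (hl'.trans hm)
    refine mul_le_mul (pow_le_pow_left₀ l.cast_nonneg (hl'.trans hm) n) ?_ (hnn l) (by positivity)
    gcongr
    linarith
  have hsum := sum_le_card_nsmul _ _ _ hterm
  rw [Nat.card_Ico, nsmul_eq_mul, Nat.cast_sub hpm] at hsum
  refine hsum.trans ?_
  calc ((m : ℝ) - p) * (lam ^ n * (2 * √lam / lam))
      ≤ (2 * √lam) * (lam ^ n * (2 * √lam / lam)) := by gcongr; linarith
    _ = 4 * lam ^ n * (√lam ^ 2 / lam) := by ring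
    _ = 4 * lam ^ n := by rw [hsq, div_self h0.ne', mul_one]

end Correction

/-- For every natural `n` there are constants `C > 0`, `λ₀ > 0` such that for all
`λ ≥ λ₀`, `T_n(λ) = ∑_{l=0}^∞ l^n/D_λ(l)` satisfies
`|T_n(λ) − λ^{n+1}/((n+1)(n+2)) − λ^n·(log λ)/2| ≤ C·λ^n`. -/
theorem T_asymptotics (n : ℕ) :
    ∃ C > (0 : ℝ), ∃ lam₀ > (0 : ℝ), ∀ lam : ℝ, lam₀ ≤ lam →
      |(∑' l : ℕ, (l : ℝ) ^ n / D lam l)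
          - lam ^ (n + 1) / ((n + 1) * (n + 2)) - lam ^ n * Real.log lam / 2|
        ≤ C * lam ^ n := by
  refine ⟨11 + n + log 3 + (n + 13) * 2 ^ n, ?_, n + 4, by positivity, fun lam hlam => ?_⟩
  · have : 0 ≤ log 3 := log_nonneg (by norm_num)
    positivity
  have hn0 : (0 : ℝ) ≤ n := n.cast_nonneg
  have h4 : 4 ≤ lam := by linarith
  have h1 : 1 ≤ lam := by linarith
  have h0 : 0 < lam := by linarith
  have hs : 1 ≤ √lam := one_le_sqrt.2 h1
  have hsq : √lam ^ 2 = lam := sq_sqrt h0.le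
  have hm := Nat.floor_le h0.le
  have hm' := (Nat.lt_floor_add_one lam).le
  have hp := Nat.floor_le (by nlinarith : 0 ≤ lam - √lam)
  have hp' := (Nat.lt_floor_add_one (lam - √lam)).le
  have hpm : ⌊lam - √lam⌋₊ ≤ ⌊lam⌋₊ := Nat.floor_le_floor (by linarith)
  have hnm : n ≤ ⌊lam⌋₊ := Nat.le_floor (by linarith)
  set m := ⌊lam⌋₊
  set p := ⌊lam - √lam⌋₊
  have htail := sum_pow_div_D_tail_le h4 hm hm' hnm
  have hnn (l : ℕ) : 0 ≤ (l : ℝ) ^ n / D lam l := div_nonneg (by positivity) (D_pos h0 l).le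
  have hsummable : Summable fun l : ℕ => (l : ℝ) ^ n / D lam l := by
    rw [← summable_nat_add_iff m]
    refine summable_of_sum_range_le (c := (n + 13) * 2 ^ n * lam ^ n) (fun i => hnn _) fun N => ?_
    simpa only [add_comm] using htail N
  have htsum : ∑' i : ℕ, ((i + m : ℕ) : ℝ) ^ n / D lam (i + m) ≤ (n + 13) * 2 ^ n * lam ^ n := by
    refine Real.tsum_le_of_sum_range_le (fun i => hnn _) fun N => ?_
    simpa only [add_comm] using htail N
  have htsum0 : 0 ≤ ∑' i : ℕ, ((i + m : ℕ) : ℝ) ^ n / D lam (i + m) :=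
    tsum_nonneg fun i => hnn _
  have hsplit : ∑ l ∈ range m, (l : ℝ) ^ n / D lam l
      = ∑ l ∈ range m, (l : ℝ) ^ n * (1 - l / lam)
        + (∑ l ∈ range p, (l : ℝ) ^ n * ((excess lam l - 1) / lam)
          + ∑ l ∈ Ico p m, (l : ℝ) ^ n * ((excess lam l - 1) / lam)) := by
    rw [sum_range_add_sum_Ico _ hpm, ← sum_add_distrib]
    refine sum_congr rfl fun l _ => ?_
    have := D_pos h0 l
    unfold excess
    field_simp
    ring
  have hfluid := abs_le.1 (abs_sum_range_fluid_sub_le h0 hm hm' n)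
  have hlog := abs_le.1
    (abs_sum_pow_mul_excess_sub_log_le h1 (by linarith : p + √lam ≤ lam) (by linarith) n)
  have hmid := sum_Ico_pow_mul_excess_bounds h1 (by linarith) hpm hm n
  have hpow : 0 < lam ^ n := by positivity
  have hpos : 0 ≤ (n + 13) * 2 ^ n * lam ^ n := by positivity
  rw [← hsummable.sum_add_tsum_nat_add m, hsplit, abs_le]
  constructor <;> linarith [hfluid.1, hfluid.2, hlog.1, hlog.2, hmid.1, hmid.2]
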